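/- The d×d matrix Z̃ = (1 + γ(α))·𝟙_d − ∑_{k=1}^{d-1} δ_k(α)·Z_d^k is diagonal with Z̃ = ∑_{l=0}^{d-1} ( γ(α)·∑_{i=0}^{d-1} α_i/α_l ) |l⟩⟨l|; in particular all its eigenvalues γ(α)·∑_i α_i/α_l are positive, so Z̃ is positive definite and invertible. (Observation 1 of the paper.) -/

import Mathlib

open Matrix Kronecker Finset
open scoped ComplexOrder

noncomputable section

/-- `ω = exp(2πi/d)`. -/
def om (d : ℕ) : ℂ := Complex.exp (2 * Real.pi * Complex.I / d)

/-- The generalized Pauli matrix `Z_d = ∑_i ω^i |i⟩⟨i|`. -/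
def Zd (d : ℕ) : Matrix (Fin d) (Fin d) ℂ :=
  Matrix.diagonal fun i => om d ^ (i : ℕ)

/-- `γ(α) = d / ∑_{i≠j} α_i/α_j` (sum over ordered pairs `i ≠ j`). -/
def gam (d : ℕ) (α : Fin d → ℝ) : ℝ :=
  d / ∑ i : Fin d, ∑ j : Fin d, if i ≠ j then α i / α j else 0

/-- `δ_k(α) = -(γ(α)/d) ∑_{i≠j} (α_i/α_j) ω^{k(d-j)}`. -/
def delt (d : ℕ) (α : Fin d → ℝ) (k : ℕ) : ℂ :=
  -(((gam d α : ℝ) : ℂ) / d) * ∑ i : Fin d, ∑ j : Fin d,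
    if i ≠ j then ((α i / α j : ℝ) : ℂ) * om d ^ (k * (d - (j : ℕ))) else 0


lemma om_prim (d : ℕ) [NeZero d] : IsPrimitiveRoot (om d) d := by
  unfold om
  exact Complex.isPrimitiveRoot_exp d (NeZero.ne d)

lemma om_inner_sum (d : ℕ) [NeZero d] (j l : Fin d) :
    ∑ k ∈ Finset.Ico 1 d, om d ^ (k * (d - (j : ℕ))) * (om d ^ (l : ℕ)) ^ k
      = (if j = l then (d : ℂ) else 0) - 1 := by
  have hp := om_prim d
  have hd : 0 < d := NeZero.pos d
  have h1 : ∀ k, om d ^ (k * (d - (j : ℕ))) * (om d ^ (l : ℕ)) ^ k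
      = (om d ^ (d - (j : ℕ) + l)) ^ k := by
    intro k
    rw [← pow_mul, ← pow_mul, ← pow_add]
    congr 1
    ring
  simp_rw [h1]
  have h2 : ∑ k ∈ Finset.range d, (om d ^ (d - (j : ℕ) + l)) ^ k
      = if j = l then (d : ℂ) else 0 := by
    have hj := j.2
    have hl := l.2
    split_ifs with h
    · subst h
      have : d - (j : ℕ) + j = d := by omega
      rw [this, hp.pow_eq_one]
      simp
    · have hne : om d ^ (d - (j : ℕ) + l) ≠ 1 := by
        intro h0
        obtain ⟨c, hc⟩ := hp.dvd_of_pow_eq_one _ h0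
        have hjl : (j : ℕ) ≠ l := fun h' => h (Fin.ext h')
        have h3 : 0 < c := by
          rcases Nat.eq_zero_or_pos c with rfl | h
          · simp at hc; omega
          · exact h
        have h4 : c < 2 := by
          by_contra h5
          have : d * 2 ≤ d * c := Nat.mul_le_mul_left _ (by omega)
          omega
        have : c = 1 := by omega
        subst this
        omega
      rw [geom_sum_eq hne, ← pow_mul, mul_comm, pow_mul, hp.pow_eq_one]
      simp
  rw [← h2, Finset.range_eq_Ico, Finset.sum_eq_sum_Ico_succ_bot hd]
  simp

lemma S_pos (d : ℕ) (hd : 2 ≤ d) (α : Fin d → ℝ) (hpos : ∀ i, 0 < α i) :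
    0 < ∑ i : Fin d, ∑ j : Fin d, if i ≠ j then α i / α j else 0 := by
  have h0 : ∀ i j : Fin d, 0 ≤ if i ≠ j then α i / α j else 0 := by
    intro i j
    split_ifs
    · exact (div_pos (hpos i) (hpos j)).le
    · exact le_rfl
  refine Finset.sum_pos' (fun i _ => Finset.sum_nonneg fun j _ => h0 i j)
    ⟨⟨0, by omega⟩, Finset.mem_univ _, ?_⟩
  refine Finset.sum_pos' (fun j _ => h0 _ j) ⟨⟨1, by omega⟩, Finset.mem_univ _, ?_⟩
  rw [if_pos (by simp)]
  exact div_pos (hpos _) (hpos _)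

lemma entry (d : ℕ) [NeZero d] (hd : 2 ≤ d)
    (α : Fin d → ℝ) (hpos : ∀ i, 0 < α i) (l : Fin d) :
    (1 + ((gam d α : ℝ) : ℂ)) - ∑ k ∈ Finset.Ico 1 d, delt d α k * (om d ^ (l : ℕ)) ^ k
      = ((gam d α * ∑ i, α i / α l : ℝ) : ℂ) := by
  have hS := S_pos d hd α hpos
  have hd0 : (d : ℂ) ≠ 0 := by exact_mod_cast NeZero.ne d
  have hgS : gam d α * (∑ i : Fin d, ∑ j : Fin d, if i ≠ j then α i / α j else 0) = d := by
    unfold gam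
    exact div_mul_cancel₀ _ hS.ne'
  have h1 : ∑ k ∈ Finset.Ico 1 d, delt d α k * (om d ^ (l : ℕ)) ^ k
      = -(((gam d α : ℝ) : ℂ) / d) * ∑ i : Fin d, ∑ j : Fin d,
        (((if i ≠ j then α i / α j else 0 : ℝ) : ℂ) *
          ((if j = l then (d : ℂ) else 0) - 1)) := by
    simp_rw [← om_inner_sum, delt, mul_assoc, ← Finset.mul_sum]
    congr 1
    simp_rw [Finset.sum_mul, Finset.mul_sum]
    rw [Finset.sum_comm]
    refine Finset.sum_congr rfl fun i _ => ?_
    rw [Finset.sum_comm]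
    refine Finset.sum_congr rfl fun j _ => Finset.sum_congr rfl fun k _ => ?_
    split_ifs <;> simp [mul_assoc]
  have h2 : ∑ i : Fin d, ∑ j : Fin d,
        (((if i ≠ j then α i / α j else 0 : ℝ) : ℂ) *
          ((if j = l then (d : ℂ) else 0) - 1))
      = d * (((∑ i, α i / α l) - 1 : ℝ) : ℂ)
        - ((∑ i : Fin d, ∑ j : Fin d, if i ≠ j then α i / α j else 0 : ℝ) : ℂ) := by
    simp_rw [mul_sub, Finset.sum_sub_distrib, mul_ite, mul_zero, mul_one]
    congr 1
    · simp only [Finset.sum_ite_eq', Finset.mem_univ, if_true]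
      rw [← Finset.sum_mul, mul_comm, ← Complex.ofReal_sum]
      congr 2
      have : ∀ i, (if i ≠ l then α i / α l else 0) = α i / α l - if i = l then 1 else 0 := by
        intro i
        by_cases h : i = l
        · subst h; simp [(hpos i).ne']
        · simp [h]
      simp_rw [this, Finset.sum_sub_distrib]
      simp
    · simp only [Complex.ofReal_sum]
  rw [h1, h2]
  have hg' := congrArg (fun x : ℝ => (x : ℂ)) hgS
  simp only [Complex.ofReal_mul, Complex.ofReal_natCast] at hg'
  generalize ((∑ i : Fin d, ∑ j : Fin d, if i ≠ j then α i / α j else 0 : ℝ) : ℂ) = S at *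
  rw [Complex.ofReal_mul, Complex.ofReal_sub]
  generalize ((∑ i, α i / α l : ℝ) : ℂ) = T at *
  field_simp
  push_cast
  linear_combination -hg'

/-- Observation 1: the matrix `Z̃ = (1+γ(α))𝟙 − ∑_{k=1}^{d-1} δ_k(α) Z_d^k` is the
diagonal matrix with entries `γ(α)·∑_i α_i/α_l`; in particular it is positive definite and
invertible. -/
theorem tildeZ_diagonal_posDef (d : ℕ) [NeZero d] (hd : 2 ≤ d)
    (α : Fin d → ℝ) (hpos : ∀ i, 0 < α i) (hnorm : ∑ i, α i ^ 2 = 1) :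
    ((1 + ((gam d α : ℝ) : ℂ)) • (1 : Matrix (Fin d) (Fin d) ℂ)
        - ∑ k ∈ Finset.Ico 1 d, delt d α k • Zd d ^ k)
      = Matrix.diagonal (fun l => ((gam d α * ∑ i, α i / α l : ℝ) : ℂ))
    ∧ ((1 + ((gam d α : ℝ) : ℂ)) • (1 : Matrix (Fin d) (Fin d) ℂ)
        - ∑ k ∈ Finset.Ico 1 d, delt d α k • Zd d ^ k).PosDef
    ∧ IsUnit ((1 + ((gam d α : ℝ) : ℂ)) • (1 : Matrix (Fin d) (Fin d) ℂ)
        - ∑ k ∈ Finset.Ico 1 d, delt d α k • Zd d ^ k) := by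
  have hmain : ((1 + ((gam d α : ℝ) : ℂ)) • (1 : Matrix (Fin d) (Fin d) ℂ)
        - ∑ k ∈ Finset.Ico 1 d, delt d α k • Zd d ^ k)
      = Matrix.diagonal (fun l => ((gam d α * ∑ i, α i / α l : ℝ) : ℂ)) := by
    ext a b
    rw [Matrix.sub_apply, Matrix.sum_apply]
    by_cases h : a = b
    · subst h
      rw [Matrix.diagonal_apply_eq, ← entry d hd α hpos a]
      simp [Zd, Matrix.diagonal_pow]
    · simp [Zd, Matrix.diagonal_pow, h]
  rw [hmain]
  have hg : 0 < gam d α := by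
    unfold gam
    exact div_pos (by exact_mod_cast NeZero.pos d) (S_pos d hd α hpos)
  have hP : (Matrix.diagonal (fun l => ((gam d α * ∑ i, α i / α l : ℝ) : ℂ))).PosDef := by
    refine Matrix.PosDef.diagonal fun l => ?_
    have : 0 < gam d α * ∑ i, α i / α l :=
      mul_pos hg (Finset.sum_pos (fun i _ => div_pos (hpos i) (hpos l)) ⟨l, Finset.mem_univ _⟩)
    exact_mod_cast this
  exact ⟨rfl, hP, hP.isUnit⟩
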